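/- arXiv:0912.3865 — 2 statements merged into one kernel-verified Lean document; each statement's English description precedes it below -/
import Mathlib

section
/- Let H ∈ (1/2, 1) and let μ be a nonnegative Borel measure on ℝ^d. If ∫_{{ξ : 0 < |ξ| ≤ 1}} |ξ|^{−2} · (∫_0^1 ∫_0^1 sin(u|ξ|)·sin(v|ξ|)·|u−v|^{2H−2} du dv) μ(dξ) < ∞, then μ({ξ : 0 < |ξ| ≤ 1}) < ∞. (Proposition 3.8 (a)) -/
open MeasureTheory Real

/-- The kernel `|x| ^ p` is locally integrable on the line for `p > -1`. -/
lemma intervalIntegrable_abs_rpow {p : ℝ} (hp : -1 < p) (a b : ℝ) :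
    IntervalIntegrable (fun x : ℝ => |x| ^ p) volume a b := by
  refine intervalIntegrable_of_even (fun x => by simp) (fun x hx => ?_)
  refine (intervalIntegral.intervalIntegrable_rpow' (a := 0) (b := x) hp).congr ?_
  intro y hy
  rw [Set.uIoc_of_le hx.le] at hy
  simp [abs_of_pos hy.1]

lemma intervalIntegrable_abs_sub_rpow {p : ℝ} (hp : -1 < p) (u a b : ℝ) :
    IntervalIntegrable (fun v : ℝ => |u - v| ^ p) volume a b := by
  simpa using (intervalIntegrable_abs_rpow hp (u - a) (u - b)).comp_sub_left u

lemma integral_abs_sub_rpow_le {p : ℝ} (hp : -1 < p) {u : ℝ} (hu : u ∈ Set.Icc (0 : ℝ) 1) :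
    ∫ v in (0 : ℝ)..1, |u - v| ^ p ≤ ∫ w in (-1 : ℝ)..1, |w| ^ p := by
  rw [intervalIntegral.integral_comp_sub_left (fun w => |w| ^ p) u]
  refine intervalIntegral.integral_mono_interval (by linarith [hu.1]) (by linarith)
    (by linarith [hu.2]) ?_ (intervalIntegrable_abs_rpow hp _ _)
  exact Filter.Eventually.of_forall fun w => by positivity

lemma sin_mul_sin_mul_rpow_le {p r : ℝ} (u v : ℝ) :
    ‖sin (u * r) * sin (v * r) * |u - v| ^ p‖ ≤ |u - v| ^ p := by
  rw [norm_mul, norm_mul, Real.norm_of_nonneg (by positivity : 0 ≤ |u - v| ^ p)]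
  refine mul_le_of_le_one_left (by positivity) ?_
  exact mul_le_one₀ (abs_sin_le_one _) (norm_nonneg _) (abs_sin_le_one _)

lemma measurable_sin_mul_sin_mul_rpow (p r : ℝ) :
    Measurable fun z : ℝ × ℝ => sin (z.1 * r) * sin (z.2 * r) * |z.1 - z.2| ^ p := by
  have : Measurable fun z : ℝ × ℝ => |z.1 - z.2| :=
    (by fun_prop : Continuous fun z : ℝ × ℝ => |z.1 - z.2|).measurable
  exact Measurable.mul (by fun_prop) (this.pow_const p)

lemma intervalIntegrable_sin_mul_sin_mul_rpow {p : ℝ} (hp : -1 < p) (r u : ℝ) :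
    IntervalIntegrable (fun v => sin (u * r) * sin (v * r) * |u - v| ^ p) volume 0 1 := by
  refine (intervalIntegrable_abs_sub_rpow hp u 0 1).mono_fun' ?_ ?_
  · exact ((measurable_sin_mul_sin_mul_rpow p r).comp
      measurable_prodMk_left).aestronglyMeasurable
  · exact Filter.Eventually.of_forall fun v => sin_mul_sin_mul_rpow_le u v

lemma intervalIntegrable_integral_sin_mul_sin_mul_rpow {p : ℝ} (hp : -1 < p) (r : ℝ) :
    IntervalIntegrable (fun u => ∫ v in (0 : ℝ)..1, sin (u * r) * sin (v * r) * |u - v| ^ p)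
      volume 0 1 := by
  refine (intervalIntegrable_const (c := ∫ w in (-1 : ℝ)..1, |w| ^ p)).mono_fun' ?_ ?_
  · simp only [intervalIntegral.integral_of_le zero_le_one]
    exact ((measurable_sin_mul_sin_mul_rpow p r).stronglyMeasurable.integral_prod_right'
      (ν := volume.restrict (Set.Ioc 0 1))).aestronglyMeasurable
  · rw [Set.uIoc_of_le zero_le_one]
    refine (ae_restrict_mem measurableSet_Ioc).mono fun u hu => ?_
    refine le_trans ?_ (integral_abs_sub_rpow_le hp ⟨hu.1.le, hu.2⟩)
    exact intervalIntegral.norm_integral_le_of_norm_le zero_le_one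
      (Filter.Eventually.of_forall fun v _ => sin_mul_sin_mul_rpow_le u v)
      (intervalIntegrable_abs_sub_rpow hp u 0 1)

lemma mul_le_sin_mul_sin_mul_rpow {p r u v : ℝ} (hp : p ≤ 0) (hr : r ∈ Set.Icc (0 : ℝ) 1)
    (hu : u ∈ Set.Icc (0 : ℝ) 1) (hv : v ∈ Set.Icc (0 : ℝ) 1) (huv : u ≠ v) :
    (2 / π) ^ 2 * r ^ 2 * u * v ≤ sin (u * r) * sin (v * r) * |u - v| ^ p := by
  have hsin : ∀ x ∈ Set.Icc (0 : ℝ) 1, 2 / π * (x * r) ≤ sin (x * r) := fun x hx =>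
    mul_le_sin (mul_nonneg hx.1 hr.1)
      ((mul_le_one₀ hx.2 hr.1 hr.2).trans (by linarith [pi_gt_three]))
  have hu0 : 0 ≤ 2 / π * (u * r) := mul_nonneg (by positivity) (mul_nonneg hu.1 hr.1)
  have hv0 : 0 ≤ 2 / π * (v * r) := mul_nonneg (by positivity) (mul_nonneg hv.1 hr.1)
  have h1 : 1 ≤ |u - v| ^ p := one_le_rpow_of_pos_of_le_one_of_nonpos
    (abs_pos.2 (sub_ne_zero.2 huv))
    (abs_le.2 ⟨by linarith [hu.1, hv.2], by linarith [hu.2, hv.1]⟩) hp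
  have h2 := mul_le_mul (hsin u hu) (hsin v hv) hv0 (hu0.trans (hsin u hu))
  calc (2 / π) ^ 2 * r ^ 2 * u * v = 2 / π * (u * r) * (2 / π * (v * r)) := by ring
    _ ≤ sin (u * r) * sin (v * r) := h2
    _ ≤ _ := le_mul_of_one_le_right ((mul_nonneg hu0 hv0).trans h2) h1

lemma sq_div_pi_sq_le_integral {p r : ℝ} (hp : p ∈ Set.Ioc (-1 : ℝ) 0)
    (hr : r ∈ Set.Icc (0 : ℝ) 1) :
    r ^ 2 / π ^ 2 ≤
      ∫ u in (0 : ℝ)..1, ∫ v in (0 : ℝ)..1, sin (u * r) * sin (v * r) * |u - v| ^ p := by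
  have hinner : ∀ u ∈ Set.Icc (0 : ℝ) 1, (2 / π) ^ 2 * r ^ 2 / 2 * u ≤
      ∫ v in (0 : ℝ)..1, sin (u * r) * sin (v * r) * |u - v| ^ p := by
    intro u hu
    calc (2 / π) ^ 2 * r ^ 2 / 2 * u = ∫ v in (0 : ℝ)..1, (2 / π) ^ 2 * r ^ 2 * u * v := by
          rw [intervalIntegral.integral_const_mul, integral_id]; ring
      _ ≤ _ := by
        refine intervalIntegral.integral_mono_ae_restrict zero_le_one
          (Continuous.intervalIntegrable (by fun_prop) _ _)
          (intervalIntegrable_sin_mul_sin_mul_rpow hp.1 r u) ?_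
        filter_upwards [ae_restrict_mem measurableSet_Icc,
          ae_restrict_of_ae (Measure.ae_ne volume u)] with v hv hne
        exact mul_le_sin_mul_sin_mul_rpow hp.2 hr hu hv hne.symm
  calc r ^ 2 / π ^ 2 = ∫ u in (0 : ℝ)..1, (2 / π) ^ 2 * r ^ 2 / 2 * u := by
        rw [intervalIntegral.integral_const_mul, integral_id]; ring
    _ ≤ _ := intervalIntegral.integral_mono_on zero_le_one
        (Continuous.intervalIntegrable (by fun_prop) _ _)
        (intervalIntegrable_integral_sin_mul_sin_mul_rpow hp.1 r) hinner

/-- Proposition 3.8 (a). -/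
theorem wave_necessity_small_freq (H : ℝ) (hH : H ∈ Set.Ioo (1/2 : ℝ) 1) (d : ℕ)
    (μ : Measure (EuclideanSpace ℝ (Fin d)))
    (hfin : ∫⁻ ξ in {ξ : EuclideanSpace ℝ (Fin d) | 0 < ‖ξ‖ ∧ ‖ξ‖ ≤ 1},
        ENNReal.ofReal (‖ξ‖ ^ (-2 : ℝ) *
          ∫ u in (0 : ℝ)..1, ∫ v in (0 : ℝ)..1,
            Real.sin (u * ‖ξ‖) * Real.sin (v * ‖ξ‖) * |u - v| ^ (2 * H - 2)) ∂μ < ⊤) :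
    μ {ξ : EuclideanSpace ℝ (Fin d) | 0 < ‖ξ‖ ∧ ‖ξ‖ ≤ 1} < ⊤ := by
  have hS : MeasurableSet {ξ : EuclideanSpace ℝ (Fin d) | 0 < ‖ξ‖ ∧ ‖ξ‖ ≤ 1} :=
    (measurableSet_lt measurable_const measurable_norm).inter
      (measurableSet_le measurable_norm measurable_const)
  have hp : 2 * H - 2 ∈ Set.Ioc (-1 : ℝ) 0 := ⟨by linarith [hH.1], by linarith [hH.2]⟩
  have hlower : ENNReal.ofReal (1 / π ^ 2) *
      μ {ξ : EuclideanSpace ℝ (Fin d) | 0 < ‖ξ‖ ∧ ‖ξ‖ ≤ 1} < ⊤ := by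
    rw [← setLIntegral_const]
    refine lt_of_le_of_lt (setLIntegral_mono' hS fun ξ hξ => ENNReal.ofReal_le_ofReal ?_) hfin
    have hξ0 : ‖ξ‖ ≠ 0 := hξ.1.ne'
    calc 1 / π ^ 2 = ‖ξ‖ ^ (-2 : ℝ) * (‖ξ‖ ^ 2 / π ^ 2) := by
          rw [rpow_neg (norm_nonneg _), rpow_two]; field_simp
      _ ≤ _ := mul_le_mul_of_nonneg_left
        (sq_div_pi_sq_le_integral hp ⟨hξ.1.le, hξ.2⟩) (by positivity)
  exact (ENNReal.mul_lt_top_iff.1 hlower).elim (fun h => h.2) fun h => h.elim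
    (fun h => absurd h (ENNReal.ofReal_pos.2 (by positivity)).ne') fun h => h ▸ ENNReal.zero_lt_top
end

section
/- Let H ∈ (1/2, 1), λ > 0 and t > 0. Then α_H · ∫_0^t ∫_0^t sin(uλ)·sin(vλ)·|u−v|^{2H−2} du dv = c_H · λ^{−2H} · ∫_ℝ |τ|^{−(2H−1)}/(τ²−1)² · [f_t(λ,τ)² + g_t(λ,τ)²] dτ. (Spectral representation (28), obtained from Lemma B.1 by the change of variables u′ = uλ, v′ = vλ) -/
open MeasureTheory Real

theorem integral_exp_neg_mul_sq_mul_cos {s : ℝ} (hs : 0 < s) (x : ℝ) :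
    ∫ ξ : ℝ, exp (-(1 / (4 * s)) * ξ ^ 2) * cos (ξ * x) = √(4 * π * s) * exp (-s * x ^ 2) := by
  have hb : 0 < ((1 / (4 * s) : ℝ) : ℂ).re := by rw [Complex.ofReal_re]; positivity
  have key := congrArg Complex.re (fourierIntegral_gaussian hb x)
  have hre : ((π : ℂ) / ((1 / (4 * s) : ℝ) : ℂ)) ^ (1 / 2 : ℂ) *
      Complex.exp (-(x : ℂ) ^ 2 / (4 * ((1 / (4 * s) : ℝ) : ℂ))) =
      ((√(4 * π * s) * exp (-s * x ^ 2) : ℝ) : ℂ) := by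
    have h1 : (π : ℂ) / ((1 / (4 * s) : ℝ) : ℂ) = ((4 * π * s : ℝ) : ℂ) := by
      rw [← Complex.ofReal_div]; congr 1; field_simp
    have h2 : -(x : ℂ) ^ 2 / (4 * ((1 / (4 * s) : ℝ) : ℂ)) = ((-s * x ^ 2 : ℝ) : ℂ) := by
      have : (s : ℂ) ≠ 0 := by exact_mod_cast hs.ne'
      push_cast; field_simp
    rw [h1, h2, Real.sqrt_eq_rpow, Complex.ofReal_mul (_ ^ _), Complex.ofReal_exp,
      Complex.ofReal_cpow (by positivity)]
    norm_num
  rw [hre, Complex.ofReal_re] at key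
  rw [← key]
  have hpt (ξ : ℝ) : Complex.exp (Complex.I * x * ξ) *
      Complex.exp (-((1 / (4 * s) : ℝ) : ℂ) * (ξ : ℂ) ^ 2) =
      ((exp (-(1 / (4 * s)) * ξ ^ 2) : ℝ) : ℂ) * Complex.exp (((ξ * x : ℝ) : ℂ) * Complex.I) := by
    push_cast; rw [mul_comm]; congr 2; ring
  have hint : Integrable fun ξ : ℝ => ((exp (-(1 / (4 * s)) * ξ ^ 2) : ℝ) : ℂ) *
      Complex.exp (((ξ * x : ℝ) : ℂ) * Complex.I) := by
    refine Integrable.mul_bdd (c := 1) (integrable_exp_neg_mul_sq (by positivity)).ofReal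
      (by fun_prop) (.of_forall fun ξ => (Complex.norm_exp_ofReal_mul_I _).le)
  simp_rw [hpt]
  rw [← RCLike.re_eq_complex_re, ← integral_re hint]
  congr 1 with ξ
  rw [RCLike.re_eq_complex_re, Complex.re_ofReal_mul, Complex.exp_ofReal_mul_I_re]

/-- The squared modulus of the Fourier transform of the signed measure `f μ`. -/
noncomputable def powerSpectrum (μ : Measure ℝ) (f : ℝ → ℝ) (ξ : ℝ) : ℝ :=
  (∫ u, f u * cos (ξ * u) ∂μ) ^ 2 + (∫ u, f u * sin (ξ * u) ∂μ) ^ 2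

section
variable {μ : Measure ℝ} {f : ℝ → ℝ}

theorem powerSpectrum_nonneg (ξ : ℝ) : 0 ≤ powerSpectrum μ f ξ := by
  unfold powerSpectrum; positivity

theorem integrable_mul_cos (hf : Integrable f μ) (ξ : ℝ) :
    Integrable (fun u => f u * cos (ξ * u)) μ :=
  hf.mul_bdd (c := 1) (by fun_prop) (.of_forall fun u => abs_cos_le_one _)

theorem integrable_mul_sin (hf : Integrable f μ) (ξ : ℝ) :
    Integrable (fun u => f u * sin (ξ * u)) μ :=
  hf.mul_bdd (c := 1) (by fun_prop) (.of_forall fun u => abs_sin_le_one _)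

theorem continuous_powerSpectrum (hf : Integrable f μ) : Continuous (powerSpectrum μ f) := by
  have hc : Continuous fun ξ => ∫ u, f u * cos (ξ * u) ∂μ := by
    refine continuous_of_dominated (bound := fun u => ‖f u‖)
      (fun ξ => (integrable_mul_cos hf ξ).1) (fun ξ => .of_forall fun u => ?_) hf.norm
      (.of_forall fun u => by fun_prop)
    rw [norm_mul]
    exact mul_le_of_le_one_right (norm_nonneg _) (abs_cos_le_one _)
  have hs : Continuous fun ξ => ∫ u, f u * sin (ξ * u) ∂μ := by
    refine continuous_of_dominated (bound := fun u => ‖f u‖)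
      (fun ξ => (integrable_mul_sin hf ξ).1) (fun ξ => .of_forall fun u => ?_) hf.norm
      (.of_forall fun u => by fun_prop)
    rw [norm_mul]
    exact mul_le_of_le_one_right (norm_nonneg _) (abs_sin_le_one _)
  exact (hc.pow 2).add (hs.pow 2)

variable [SFinite μ]

theorem powerSpectrum_eq_integral_prod (hf : Integrable f μ) (ξ : ℝ) :
    powerSpectrum μ f ξ = ∫ p, f p.1 * f p.2 * cos (ξ * (p.1 - p.2)) ∂(μ.prod μ) := by
  have hc := integrable_mul_cos hf ξ
  have hs := integrable_mul_sin hf ξ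
  rw [powerSpectrum, sq, sq, ← integral_prod_mul, ← integral_prod_mul,
    ← integral_add (hc.mul_prod hc) (hs.mul_prod hs)]
  congr 1 with p
  rw [mul_sub, cos_sub]
  ring

theorem integral_exp_mul_powerSpectrum (hf : Integrable f μ) {s : ℝ} (hs : 0 < s) :
    ∫ ξ : ℝ, exp (-(1 / (4 * s)) * ξ ^ 2) * powerSpectrum μ f ξ =
      √(4 * π * s) * ∫ p, f p.1 * f p.2 * exp (-s * (p.1 - p.2) ^ 2) ∂(μ.prod μ) := by
  have hint : Integrable (Function.uncurry fun (ξ : ℝ) (p : ℝ × ℝ) =>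
      exp (-(1 / (4 * s)) * ξ ^ 2) * (f p.1 * f p.2 * cos (ξ * (p.1 - p.2))))
      (volume.prod (μ.prod μ)) := by
    have h := (integrable_exp_neg_mul_sq (b := 1 / (4 * s)) (by positivity)).mul_prod
      (hf.mul_prod hf)
    have h' := h.mul_bdd (c := 1) (g := fun q : ℝ × ℝ × ℝ => cos (q.1 * (q.2.1 - q.2.2)))
      (by fun_prop) (.of_forall fun q => abs_cos_le_one _)
    refine h'.congr (.of_forall fun q => ?_)
    simp only [Function.uncurry]
    ring
  calc _ = ∫ ξ : ℝ, ∫ p, exp (-(1 / (4 * s)) * ξ ^ 2) *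
        (f p.1 * f p.2 * cos (ξ * (p.1 - p.2))) ∂(μ.prod μ) := by
        simp_rw [powerSpectrum_eq_integral_prod hf, integral_const_mul]
    _ = ∫ p, (∫ ξ : ℝ, exp (-(1 / (4 * s)) * ξ ^ 2) *
        (f p.1 * f p.2 * cos (ξ * (p.1 - p.2)))) ∂(μ.prod μ) := integral_integral_swap hint
    _ = _ := by
      rw [← integral_const_mul]
      congr 1 with p
      simp_rw [mul_left_comm _ (f p.1 * f p.2)]
      rw [integral_const_mul, integral_exp_neg_mul_sq_mul_cos hs]

theorem integral_rpow_mul_exp_neg_mul_sq {a x : ℝ} (ha : 0 < a) (hx : x ≠ 0) :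
    ∫ s in Set.Ioi (0 : ℝ), s ^ (a / 2 - 1) * exp (-s * x ^ 2) = Gamma (a / 2) * |x| ^ (-a) := by
  have h := Real.integral_rpow_mul_exp_neg_mul_Ioi (half_pos ha) (pow_pos (abs_pos.2 hx) 2)
  have h2 : (1 / |x| ^ 2) ^ (a / 2) = |x| ^ (-a) := by
    rw [one_div, inv_rpow (by positivity), ← rpow_natCast, ← rpow_mul (abs_nonneg x),
      rpow_neg (abs_nonneg x)]
    congr 2; push_cast; ring
  rw [h2] at h
  rw [mul_comm (Gamma _), ← h]
  congr 1 with s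
  rw [sq_abs]; ring_nf

theorem integrableOn_gaussian_scale_mixture {a x : ℝ} (ha : 0 < a) (hx : x ≠ 0) :
    IntegrableOn (fun s : ℝ => s ^ (a / 2 - 1) * exp (-s * x ^ 2)) (Set.Ioi 0) := by
  have := integrableOn_rpow_mul_exp_neg_mul_rpow (p := 1) (s := a / 2 - 1) (b := x ^ 2)
    (by linarith) one_pos (by positivity)
  refine this.congr_fun (fun s _ => ?_) measurableSet_Ioi
  simp only [rpow_one]; ring_nf

theorem integral_rpow_mul_exp_neg_div {a ξ : ℝ} (ha : a < 1) (hξ : ξ ≠ 0) :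
    ∫ s in Set.Ioi (0 : ℝ), s ^ (a / 2 - 3 / 2) * exp (-(1 / (4 * s)) * ξ ^ 2) =
      Gamma ((1 - a) / 2) * 2 ^ (1 - a) * |ξ| ^ (a - 1) := by
  have h := integral_rpow_mul_exp_neg_mul_sq (a := 1 - a) (x := ξ / 2) (by linarith) (by simpa)
  rw [← integral_comp_rpow_Ioi _ (show (-1 : ℝ) ≠ 0 by norm_num)] at h
  have h2 : |ξ / 2| ^ (-(1 - a)) = 2 ^ (1 - a) * |ξ| ^ (a - 1) := by
    rw [abs_div, div_rpow (by positivity) (by positivity), abs_two, rpow_neg zero_le_two,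
      div_inv_eq_mul, mul_comm, neg_sub]
  rw [h2, ← mul_assoc] at h
  rw [← h]
  refine setIntegral_congr_fun measurableSet_Ioi fun s (hs : 0 < s) => ?_
  simp only [smul_eq_mul, abs_neg, abs_one, one_mul]
  rw [← rpow_mul hs.le, ← mul_assoc, ← rpow_add hs, rpow_neg_one]
  congr 2
  · ring
  · field_simp; ring

theorem integrable_rpow_mul_gaussian_prod (hf : Integrable f μ) [NullSingletonClass μ] {a : ℝ} (ha : 0 < a)
    (hfa : Integrable (fun p => f p.1 * f p.2 * |p.1 - p.2| ^ (-a)) (μ.prod μ)) :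
    Integrable (Function.uncurry fun (p : ℝ × ℝ) (s : ℝ) =>
      f p.1 * f p.2 * (s ^ (a / 2 - 1) * exp (-s * (p.1 - p.2) ^ 2)))
      ((μ.prod μ).prod (volume.restrict (Set.Ioi 0))) := by
  have hdiag : ∀ᵐ p ∂(μ.prod μ), p.1 - p.2 ≠ 0 := by
    have hm : MeasurableSet {p : ℝ × ℝ | p.1 - p.2 = 0} :=
      measurableSet_eq_fun (by fun_prop) (by fun_prop)
    refine (Measure.ae_prod_iff_ae_ae hm.compl).2 (.of_forall fun x => ?_)
    filter_upwards [compl_mem_ae_iff.2 (measure_singleton x)] with y hy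
    exact sub_ne_zero.2 (Ne.symm hy)
  have hmeas : AEStronglyMeasurable (Function.uncurry fun (p : ℝ × ℝ) (s : ℝ) =>
      f p.1 * f p.2 * (s ^ (a / 2 - 1) * exp (-s * (p.1 - p.2) ^ 2)))
      ((μ.prod μ).prod (volume.restrict (Set.Ioi 0))) :=
    ((hf.mul_prod hf).1.comp_fst).mul
      (Measurable.aestronglyMeasurable (by fun_prop))
  refine (integrable_prod_iff hmeas).2 ⟨?_, ?_⟩
  · filter_upwards [hdiag] with p hp
    exact (integrableOn_gaussian_scale_mixture ha hp).const_mul (f p.1 * f p.2)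
  · refine (hfa.norm.const_mul (Gamma (a / 2))).congr ?_
    filter_upwards [hdiag] with p hp
    simp only [Function.uncurry, norm_mul (f p.1 * f p.2), integral_const_mul]
    rw [norm_of_nonneg (rpow_nonneg (abs_nonneg _) _), mul_left_comm,
      ← integral_rpow_mul_exp_neg_mul_sq ha hp]
    congr 1
    refine setIntegral_congr_fun measurableSet_Ioi fun s (hs : 0 < s) => ?_
    exact (norm_of_nonneg (by positivity)).symm

/-- The Riesz energy of `f μ` in terms of its Fourier transform. -/
theorem integral_mul_abs_sub_rpow_eq (hf : Integrable f μ) [NullSingletonClass μ] {a : ℝ} (ha : 0 < a)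
    (ha1 : a < 1)
    (hfa : Integrable (fun p => f p.1 * f p.2 * |p.1 - p.2| ^ (-a)) (μ.prod μ)) :
    Gamma (a / 2) * √(4 * π) * ∫ p, f p.1 * f p.2 * |p.1 - p.2| ^ (-a) ∂(μ.prod μ) =
      Gamma ((1 - a) / 2) * 2 ^ (1 - a) * ∫ ξ, |ξ| ^ (a - 1) * powerSpectrum μ f ξ := by
  have hI := integrable_rpow_mul_gaussian_prod hf ha hfa
  have hspace : ∫ s in Set.Ioi (0 : ℝ), ∫ p, f p.1 * f p.2 *
        (s ^ (a / 2 - 1) * exp (-s * (p.1 - p.2) ^ 2)) ∂(μ.prod μ) =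
      Gamma (a / 2) * ∫ p, f p.1 * f p.2 * |p.1 - p.2| ^ (-a) ∂(μ.prod μ) := by
    rw [← integral_integral_swap hI, ← integral_const_mul]
    congr 1 with p
    rw [integral_const_mul]
    rcases eq_or_ne (p.1 - p.2) 0 with hp | hp
    · have h0 : p.1 = p.2 := sub_eq_zero.1 hp
      have h : ∫ s in Set.Ioi (0 : ℝ), s ^ (a / 2 - 1) = 0 := by
        refine integral_undef fun h => not_integrableOn_Ioi_rpow _ h
      simp [hp, zero_rpow (neg_ne_zero.2 ha.ne'), h]
    · rw [integral_rpow_mul_exp_neg_mul_sq ha hp]; ring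
  have hscale {s : ℝ} (hs : 0 < s) :
      ∫ ξ, s ^ (a / 2 - 3 / 2) * exp (-(1 / (4 * s)) * ξ ^ 2) * powerSpectrum μ f ξ =
      √(4 * π) * ∫ p, f p.1 * f p.2 *
        (s ^ (a / 2 - 1) * exp (-s * (p.1 - p.2) ^ 2)) ∂(μ.prod μ) := by
    simp_rw [mul_assoc (s ^ (a / 2 - 3 / 2)), mul_left_comm _ (s ^ (a / 2 - 1))]
    rw [integral_const_mul, integral_const_mul, integral_exp_mul_powerSpectrum hf hs,
      sqrt_mul (by positivity), sqrt_eq_rpow s,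
      show a / 2 - 1 = a / 2 - 3 / 2 + 1 / 2 by ring, rpow_add hs]
    ring
  have hJ : Integrable (Function.uncurry fun s ξ : ℝ =>
      s ^ (a / 2 - 3 / 2) * exp (-(1 / (4 * s)) * ξ ^ 2) * powerSpectrum μ f ξ)
      ((volume.restrict (Set.Ioi 0)).prod volume) := by
    have hP := (continuous_powerSpectrum hf).measurable
    refine (integrable_prod_iff (Measurable.aestronglyMeasurable (by fun_prop))).2 ⟨?_, ?_⟩
    · refine (ae_restrict_iff' measurableSet_Ioi).2 (.of_forall fun s (hs : 0 < s) => ?_)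
      refine Integrable.mul_bdd (c := (∫ u, ‖f u‖ ∂μ) ^ 2 + (∫ u, ‖f u‖ ∂μ) ^ 2)
        ((integrable_exp_neg_mul_sq (b := 1 / (4 * s)) (by positivity)).const_mul
          (s ^ (a / 2 - 3 / 2)))
        hP.aestronglyMeasurable (.of_forall fun ξ => ?_)
      rw [norm_of_nonneg (powerSpectrum_nonneg ξ), powerSpectrum]
      refine add_le_add ?_ ?_ <;>
      · rw [← sq_abs, ← norm_eq_abs]
        refine pow_le_pow_left₀ (norm_nonneg _) ?_ 2
        refine norm_integral_le_of_norm_le hf.norm (.of_forall fun u => ?_)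
        rw [norm_mul]
        refine mul_le_of_le_one_right (norm_nonneg _) ?_
        first | exact abs_cos_le_one _ | exact abs_sin_le_one _
    · refine (hI.integral_prod_right.const_mul √(4 * π)).congr ?_
      refine (ae_restrict_iff' measurableSet_Ioi).2 (.of_forall fun s (hs : 0 < s) => ?_)
      refine (hscale hs).symm.trans ?_
      congr 1 with ξ
      exact (norm_of_nonneg (mul_nonneg (by positivity) (powerSpectrum_nonneg ξ))).symm
  have hfreq : ∫ s in Set.Ioi (0 : ℝ), ∫ ξ,
        s ^ (a / 2 - 3 / 2) * exp (-(1 / (4 * s)) * ξ ^ 2) * powerSpectrum μ f ξ =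
      Gamma ((1 - a) / 2) * 2 ^ (1 - a) * ∫ ξ, |ξ| ^ (a - 1) * powerSpectrum μ f ξ := by
    rw [integral_integral_swap hJ, ← integral_const_mul]
    refine integral_congr_ae ?_
    filter_upwards [compl_mem_ae_iff.2 (measure_singleton (0 : ℝ))] with ξ hξ
    rw [integral_mul_const, integral_rpow_mul_exp_neg_div ha1 hξ]
    ring
  rw [← hfreq, mul_right_comm, ← hspace, mul_comm, ← integral_const_mul]
  exact setIntegral_congr_fun measurableSet_Ioi fun s hs => (hscale hs).symm

end

theorem integrable_abs_sub_rpow {a : ℝ} (ha : a < 1) {t : ℝ} (ht : 0 ≤ t) :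
    Integrable (fun p : ℝ × ℝ => |p.1 - p.2| ^ (-a))
      ((volume.restrict (Set.Ioc 0 t)).prod (volume.restrict (Set.Ioc 0 t))) := by
  have hg : Integrable ((Set.Ioc (-t) t).indicator fun x : ℝ => |x| ^ (-a)) := by
    refine (integrable_indicator_iff measurableSet_Ioc).2 ?_
    have hpos : IntervalIntegrable (fun x : ℝ => |x| ^ (-a)) volume 0 t := by
      refine (intervalIntegral.intervalIntegrable_rpow' (r := -a) (by linarith)).congr
        fun x hx => ?_
      rw [Set.uIoc_of_le ht] at hx
      simp only [abs_of_pos hx.1]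
    have hneg : IntervalIntegrable (fun x : ℝ => |x| ^ (-a)) volume (-t) 0 := by
      rw [IntervalIntegrable.iff_comp_neg]
      simpa using hpos.symm
    exact (hneg.trans hpos).1
  have h1 : Integrable ((Set.Ioc 0 t).indicator fun _ : ℝ => (1 : ℝ)) :=
    (integrable_indicator_iff measurableSet_Ioc).2 (by simp)
  have h := h1.convolution_integrand (ContinuousLinearMap.mul ℝ ℝ) hg
  rw [Measure.prod_restrict]
  refine h.integrableOn.congr_fun (s := Set.Ioc 0 t ×ˢ Set.Ioc 0 t) (fun p hp => ?_)
    (measurableSet_Ioc.prod measurableSet_Ioc)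
  obtain ⟨⟨h1, h2⟩, h3, h4⟩ := hp
  have h5 : p.1 - p.2 ∈ Set.Ioc (-t) t := ⟨by linarith, by linarith⟩
  simp [Set.indicator_of_mem h5, h3, h4]

theorem fractional_gamma_identity {H : ℝ} (hH : 1 / 2 < H) (hH1 : H < 1) :
    H * (2 * H - 1) * (Gamma (H - 1 / 2) * 2 ^ (2 * H - 1)) =
      Gamma (2 * H + 1) * sin (π * H) / (2 * π) * (Gamma (1 - H) * √(4 * π)) := by
  have h1 := Gamma_mul_Gamma_add_half (H - 1 / 2)
  have h2 := Gamma_mul_Gamma_one_sub H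
  have h3 : Gamma (2 * H + 1) = 2 * H * ((2 * H - 1) * Gamma (2 * H - 1)) := by
    rw [Gamma_add_one (by linarith), ← Gamma_add_one (s := 2 * H - 1) (by linarith),
      sub_add_cancel]
  have hs : 0 < sin (π * H) := sin_pos_of_pos_of_lt_pi (by positivity) (by nlinarith [pi_pos])
  have hG : 0 < Gamma H := Gamma_pos_of_pos (by linarith)
  have h4 : √(4 * π) = 2 * √π := by
    rw [sqrt_mul (by norm_num), show (4 : ℝ) = 2 ^ 2 by norm_num, sqrt_sq (by norm_num)]
  have h5 : (2 : ℝ) ^ (1 - 2 * (H - 1 / 2)) * 2 ^ (2 * H - 1) = 2 := by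
    rw [← rpow_add two_pos]; ring_nf; simp
  rw [sub_add_cancel, show 2 * (H - 1 / 2) = 2 * H - 1 by ring] at h1
  rw [show 2 * (H - 1 / 2) = 2 * H - 1 by ring] at h5
  have h6 : sin (π * H) / π * (Gamma H * Gamma (1 - H)) = 1 := by
    rw [h2]; field_simp
  refine mul_left_cancel₀ hG.ne' ?_
  rw [h3, h4]
  calc _ = H * (2 * H - 1) * (Gamma (H - 1 / 2) * Gamma H) * 2 ^ (2 * H - 1) := by ring
    _ = H * (2 * H - 1) * Gamma (2 * H - 1) * √π *
        (2 ^ (1 - (2 * H - 1)) * 2 ^ (2 * H - 1)) := by rw [h1]; ring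
    _ = H * (2 * H - 1) * Gamma (2 * H - 1) * √π * 2 *
        (sin (π * H) / π * (Gamma H * Gamma (1 - H))) := by rw [h5, h6]; ring
    _ = _ := by field_simp

theorem powerSpectrum_sin {l t τ : ℝ} (hl : 0 < l) (ht : 0 < t) (hτ : τ ^ 2 - 1 ≠ 0) :
    powerSpectrum (volume.restrict (Set.Ioc 0 t)) (fun u => sin (u * l)) (l * τ) =
      (l ^ 2)⁻¹ * (((sin (τ * l * t) - τ * sin (l * t)) ^ 2 +
         (cos (τ * l * t) - cos (l * t)) ^ 2) / (τ ^ 2 - 1) ^ 2) := by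
  have hd : l * (τ ^ 2 - 1) ≠ 0 := mul_ne_zero hl.ne' hτ
  have hlin (c u : ℝ) : HasDerivAt (fun u : ℝ => c * u) c u := by
    simpa using (hasDerivAt_id u).const_mul c
  have hC : ∫ u in (0 : ℝ)..t, sin (u * l) * cos (l * τ * u) =
      (cos (l * t) * cos (l * τ * t) + τ * (sin (l * t) * sin (l * τ * t)) - 1) /
        (l * (τ ^ 2 - 1)) := by
    rw [intervalIntegral.integral_eq_sub_of_hasDerivAt (f := fun u =>
      (cos (l * u) * cos (l * τ * u) + τ * (sin (l * u) * sin (l * τ * u))) /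
        (l * (τ ^ 2 - 1))) (fun u _ => ?_) (Continuous.intervalIntegrable (by fun_prop) _ _)]
    · simp only [mul_zero, cos_zero, sin_zero]; ring
    · have := ((((hlin l u).cos.mul (hlin (l * τ) u).cos).add
        (((hlin l u).sin.mul (hlin (l * τ) u).sin).const_mul τ)).div_const (l * (τ ^ 2 - 1)))
      refine this.congr_deriv ?_
      rw [mul_comm u l]
      field_simp
      ring
  have hS : ∫ u in (0 : ℝ)..t, sin (u * l) * sin (l * τ * u) =
      (cos (l * t) * sin (l * τ * t) - τ * (sin (l * t) * cos (l * τ * t))) /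
        (l * (τ ^ 2 - 1)) := by
    rw [intervalIntegral.integral_eq_sub_of_hasDerivAt (f := fun u =>
      (cos (l * u) * sin (l * τ * u) - τ * (sin (l * u) * cos (l * τ * u))) /
        (l * (τ ^ 2 - 1))) (fun u _ => ?_) (Continuous.intervalIntegrable (by fun_prop) _ _)]
    · simp
    · have := ((((hlin l u).cos.mul (hlin (l * τ) u).sin).sub
        (((hlin l u).sin.mul (hlin (l * τ) u).cos).const_mul τ)).div_const (l * (τ ^ 2 - 1)))
      refine this.congr_deriv ?_
      rw [mul_comm u l]
      field_simp
      ring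
  rw [powerSpectrum, ← intervalIntegral.integral_of_le ht.le,
    ← intervalIntegral.integral_of_le ht.le, hC, hS, mul_comm τ l, div_pow, div_pow,
    ← add_div, mul_pow, inv_mul_eq_div, div_div, mul_comm (l ^ 2)]
  congr 1
  have h2 := sin_sq_add_cos_sq (l * τ * t)
  generalize sin (l * t) = x at *
  generalize cos (l * t) = y at *
  generalize sin (l * τ * t) = z at *
  generalize cos (l * τ * t) = w at *
  linear_combination (y ^ 2 + τ ^ 2 * x ^ 2 - 1) * h2

/-- Spectral representation (28) of the `𝓗(0,t)`-norm of `u ↦ sin(uλ)`. -/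
theorem H_norm_sin_scaled (H l t : ℝ) (hH : H ∈ Set.Ioo (1/2 : ℝ) 1)
    (hl : 0 < l) (ht : 0 < t) :
    H * (2 * H - 1) *
      ∫ u in (0 : ℝ)..t, ∫ v in (0 : ℝ)..t,
        Real.sin (u * l) * Real.sin (v * l) * |u - v| ^ (2 * H - 2) =
    (Real.Gamma (2 * H + 1) * Real.sin (Real.pi * H) / (2 * Real.pi)) * l ^ (-(2 * H)) *
      ∫ τ : ℝ, |τ| ^ (-(2 * H - 1)) / (τ ^ 2 - 1) ^ 2 *
        ((Real.sin (τ * l * t) - τ * Real.sin (l * t)) ^ 2 +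
         (Real.cos (τ * l * t) - Real.cos (l * t)) ^ 2) := by
  obtain ⟨hH0, hH1⟩ := hH
  set μ : Measure ℝ := volume.restrict (Set.Ioc 0 t) with hμ
  set f : ℝ → ℝ := fun u => sin (u * l) with hf_def
  have hf : Integrable f μ :=
    (Continuous.integrableOn_Icc (by fun_prop)).mono_set Set.Ioc_subset_Icc_self
  have hfa : Integrable (fun p : ℝ × ℝ => f p.1 * f p.2 * |p.1 - p.2| ^ (-(2 - 2 * H)))
      (μ.prod μ) := by
    refine (integrable_abs_sub_rpow (by linarith) ht.le).bdd_mul (c := 1) (by fun_prop)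
      (.of_forall fun p => ?_)
    rw [norm_mul]
    exact mul_le_one₀ (abs_sin_le_one _) (norm_nonneg _) (abs_sin_le_one _)
  have key := integral_mul_abs_sub_rpow_eq hf (by linarith) (by linarith) hfa
  rw [integral_prod _ hfa, show (2 - 2 * H) / 2 = 1 - H by ring,
    show (1 - (2 - 2 * H)) / 2 = H - 1 / 2 by ring, show 1 - (2 - 2 * H) = 2 * H - 1 by ring,
    show 2 - 2 * H - 1 = 1 - 2 * H by ring, neg_sub] at key
  have hscale : ∫ ξ, |ξ| ^ (1 - 2 * H) * powerSpectrum μ f ξ = l ^ (-(2 * H)) *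
      ∫ τ : ℝ, |τ| ^ (-(2 * H - 1)) / (τ ^ 2 - 1) ^ 2 *
        ((sin (τ * l * t) - τ * sin (l * t)) ^ 2 + (cos (τ * l * t) - cos (l * t)) ^ 2) := by
    have h := Measure.integral_comp_mul_left (fun ξ => |ξ| ^ (1 - 2 * H) * powerSpectrum μ f ξ) l
    rw [abs_of_pos (inv_pos.2 hl), smul_eq_mul, eq_inv_mul_iff_mul_eq₀ hl.ne'] at h
    rw [← h, ← integral_const_mul, ← integral_const_mul]
    refine integral_congr_ae ?_
    filter_upwards [compl_mem_ae_iff.2 ((Set.toFinite {(1 : ℝ), -1}).measure_zero volume)]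
      with τ hτ
    have hτ' : τ ^ 2 - 1 ≠ 0 := fun h0 =>
      hτ (by simpa using sub_eq_zero.1 h0)
    have hpow : l * l ^ (1 - 2 * H) * (l ^ 2)⁻¹ = l ^ (-(2 * H)) := by
      rw [show 1 - 2 * H = -(2 * H) + 1 by ring, rpow_add_one hl.ne']
      field_simp
    rw [powerSpectrum_sin hl ht hτ', abs_mul, abs_of_pos hl, mul_rpow hl.le (abs_nonneg τ),
      ← hpow, neg_sub]
    ring
  simp_rw [intervalIntegral.integral_of_le ht.le]
  rw [mul_assoc (Gamma (2 * H + 1) * sin (π * H) / (2 * π)), ← hscale]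
  have hK : Gamma (1 - H) * √(4 * π) ≠ 0 :=
    mul_ne_zero (Gamma_pos_of_pos (by linarith)).ne' (by positivity)
  refine mul_left_cancel₀ hK ?_
  rw [mul_left_comm, key, ← mul_assoc, fractional_gamma_identity hH0 hH1]
  ring
end
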